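/- arXiv:2302.08315 — 2 statements merged into one kernel-verified Lean document; each statement's English description precedes it below -/
import Mathlib

section
/- Let A, B be elements of a commutative ring R. For every positive integer n, det[u_{|j−k|}(A,B)]_{1≤j,k≤n} = (−1)^{n−1}·u_{n−1}(2A, (B+1)^2). -/
def lucasU {R : Type*} [CommRing R] (x y : R) : ℕ → R
  | 0 => 0
  | 1 => 1
  | n + 2 => x * lucasU x y (n + 1) - y * lucasU x y n

def lucasV {R : Type*} [CommRing R] (x y : R) : ℕ → R
  | 0 => 2
  | 1 => x
  | n + 2 => x * lucasV x y (n + 1) - y * lucasV x y n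

def triE {R : Type*} [CommRing R] (d e : ℕ → R) (j k : ℕ) : R :=
  if j = k then d j else if j + 1 = k then e j else if k + 1 = j then e k else 0

theorem triE_shift {R : Type*} [CommRing R] (d e : ℕ → R) (j k : ℕ) :
    triE d e (j + 1) (k + 1) = triE (fun i => d (i + 1)) (fun i => e (i + 1)) j k := by
  simp [triE]

def triD {R : Type*} [CommRing R] (d e : ℕ → R) (n : ℕ) : R :=
  Matrix.det (Matrix.of fun j k : Fin n => triE d e j k)

theorem triD_rec {R : Type*} [CommRing R] (d e : ℕ → R) (n : ℕ) :
    triD d e (n + 2) = d 0 * triD (fun i => d (i + 1)) (fun i => e (i + 1)) (n + 1)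
      - e 0 ^ 2 * triD (fun i => d (i + 2)) (fun i => e (i + 2)) n := by
  unfold triD
  rw [Matrix.det_succ_row_zero, Fin.sum_univ_succ, Fin.sum_univ_succ, Finset.sum_eq_zero]
  · have h1 : ((Matrix.of fun j k : Fin (n + 2) => triE d e j k).submatrix Fin.succ
        (Fin.succAbove 0)) = Matrix.of fun j k : Fin (n + 1) =>
          triE (fun i => d (i + 1)) (fun i => e (i + 1)) j k := by
      ext j k
      simp [triE_shift]
    have h2 : ((Matrix.of fun j k : Fin (n + 2) => triE d e j k).submatrix Fin.succ
        (Fin.succAbove (Fin.succ 0))).det = e 0 * (Matrix.of fun j k : Fin n =>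
          triE (fun i => d (i + 2)) (fun i => e (i + 2)) j k).det := by
      rw [Matrix.det_succ_column_zero, Fin.sum_univ_succ, Finset.sum_eq_zero]
      · have h3 : (((Matrix.of fun j k : Fin (n + 2) => triE d e j k).submatrix Fin.succ
            (Fin.succAbove (Fin.succ 0))).submatrix (Fin.succAbove 0) Fin.succ) =
            Matrix.of fun j k : Fin n =>
              triE (fun i => d (i + 2)) (fun i => e (i + 2)) j k := by
          ext j k
          simp [triE_shift, Fin.succ_succAbove_succ]
        rw [h3]
        simp [triE]
      · intro i _
        simp [triE, Fin.succAbove]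
    rw [h1, h2]
    simp [triE]
    ring
  · intro i _
    simp [triE]

theorem triD_const {R : Type*} [CommRing R] (A B : R) (n : ℕ) :
    triD (fun _ => -2 * A) (fun _ => B + 1) n =
      (-1) ^ n * lucasU (2 * A) ((B + 1) ^ 2) (n + 1) := by
  induction n using Nat.twoStepInduction with
  | zero => simp [triD, lucasU]
  | one => simp [triD, lucasU, triE]
  | more n h1 h2 =>
    rw [triD_rec, h1, h2, show lucasU (2 * A) ((B + 1) ^ 2) (n + 2 + 1) = 2 * A * lucasU (2 * A) ((B + 1) ^ 2) (n + 1 + 1) - (B + 1) ^ 2 * lucasU (2 * A) ((B + 1) ^ 2) (n + 1) from rfl]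
    ring

/-- unitriangular transformation -/
def lowE {R : Type*} [CommRing R] (A B : R) (j k : ℕ) : R :=
  (if k = j then 1 else 0) + (if 2 ≤ j then (if k = j - 1 then -A else 0) else 0)
    + (if 2 ≤ j then (if k = j - 2 then B else 0) else 0)

def opE {R : Type*} [CommRing R] (A B : R) (f : ℕ → R) (j : ℕ) : R :=
  if 2 ≤ j then f j - A * f (j - 1) + B * f (j - 2) else f j

theorem lowE_sum {R : Type*} [CommRing R] (A B : R) (n j : ℕ) (hj : j < n) (f : ℕ → R) :
    ∑ k : Fin n, lowE A B j k * f k = opE A B f j := by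
  rw [Fin.sum_univ_eq_sum_range (fun k => lowE A B j k * f k) n]
  unfold lowE opE
  have h1 : j - 1 < n := by omega
  have h2 : j - 2 < n := by omega
  by_cases h : 2 ≤ j
  · simp [h, add_mul, Finset.sum_add_distrib, ite_mul, hj, h1, h2]
    ring
  · simp [h, ite_mul, hj]

def uu {R : Type*} [CommRing R] (A B : R) (j k : ℕ) : R := lucasU A B ((j : ℤ) - (k : ℤ)).natAbs

theorem uu_add {R : Type*} [CommRing R] (A B : R) (j m : ℕ) : uu A B (j + m) j = lucasU A B m := by
  unfold uu; congr 1; omega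

theorem uu_add' {R : Type*} [CommRing R] (A B : R) (j m : ℕ) : uu A B j (j + m) = lucasU A B m := by
  unfold uu; congr 1; omega

theorem uu_comm {R : Type*} [CommRing R] (A B : R) (j k : ℕ) : uu A B j k = uu A B k j := by
  unfold uu; congr 1; omega

/-- row-transformed entries -/
theorem row_low {R : Type*} [CommRing R] (A B : R) (k m : ℕ) :
    uu A B (k + m + 2) k - A * uu A B (k + m + 1) k + B * uu A B (k + m) k = 0 := by
  rw [add_assoc k m 2, add_assoc k m 1, uu_add, uu_add, uu_add, lucasU]; ring

theorem op_eval {R : Type*} [CommRing R] (A B : R) (j k : ℕ) :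
    opE A B (fun l => opE A B (fun i => uu A B i l) j) k =
      triE (fun i => if 2 ≤ i then -2 * A else 0) (fun i => if 1 ≤ i then B + 1 else 1) j k := by
  have key : ∀ a l : ℕ, l ≤ a →
      uu A B (a + 2) l - A * uu A B (a + 1) l + B * uu A B a l = 0 := by
    intro a l h
    obtain ⟨m, rfl⟩ := Nat.exists_eq_add_of_le h
    exact row_low A B l m
  have key' : ∀ a l : ℕ, l ≤ a →
      uu A B l (a + 2) - A * uu A B l (a + 1) + B * uu A B l a = 0 := by
    intro a l h
    rw [uu_comm, uu_comm A B l, uu_comm A B l]; exact key a l h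
  have c0 : ∀ i, uu A B i i = 0 := fun i => uu_add A B i 0
  have c1 : ∀ i, uu A B (i + 1) i = 1 := fun i => uu_add A B i 1
  have c1' : ∀ i, uu A B i (i + 1) = 1 := fun i => uu_add' A B i 1
  have c2 : ∀ i, uu A B (i + 2) i = A := fun i => by rw [uu_add]; simp [lucasU]
  have c2' : ∀ i, uu A B i (i + 2) = A := fun i => by rw [uu_add']; simp [lucasU]
  rcases j with _ | _ | j <;> rcases k with _ | _ | k
  · simp [opE, triE, c0]
  · simp [opE, triE, c1']
  · simpa [opE, triE] using key' k 0 (by omega)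
  · simp [opE, triE, c1]
  · simp [opE, triE, c0]
  · rcases k with _ | k
    · simp [opE, triE, c1', c0, uu_comm A B 1 0, c1' 1]; ring
    · simpa [opE, triE] using key' (k+1) 1 (by omega)
  · simpa [opE, triE] using key j 0 (by omega)
  · rcases j with _ | j
    · simp [opE, triE, c1', c0, c1 1]; ring
    · simpa [opE, triE] using key (j+1) 1 (by omega)
  · simp only [opE, triE, show ∀ i, 2 ≤ i + 1 + 1 from fun i => by omega, if_true,
      show ∀ i, i + 1 + 1 - 1 = i + 1 from fun i => by omega,
      show ∀ i, i + 1 + 1 - 2 = i from fun i => by omega,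
      show ∀ i, 1 ≤ i + 1 + 1 from fun i => by omega]
    rcases lt_trichotomy j k with h | h | h
    · have a1 := key' k j (by omega)
      have a2 := key' k (j + 1) (by omega)
      by_cases hk : k = j + 1
      · subst hk
        have e1 := c1' (j + 2)
        have e2 := c0 (j + 2)
        have e3 := c1 (j + 1)
        simp only [add_assoc, Nat.reduceAdd] at a1 a2 e1 e2 e3 ⊢
        simp
        linear_combination B * a1 - A * a2 + e1 - A * e2 + B * e3
      · have a3 := key' k (j + 2) (by omega)
        rw [if_neg (by omega), if_neg (by omega), if_neg (by omega)]
        linear_combination B * a1 - A * a2 + a3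
    · subst h
      simp [c0, c1, c1', c2, c2']
      ring
    · have a1 := key j k (by omega)
      have a2 := key j (k + 1) (by omega)
      by_cases hk : j = k + 1
      · subst hk
        have e1 := c1 (k + 2)
        have e2 := c0 (k + 2)
        have e3 := c1' (k + 1)
        simp only [add_assoc, Nat.reduceAdd] at a1 a2 e1 e2 e3 ⊢
        simp
        linear_combination B * a1 - A * a2 + e1 - A * e2 + B * e3
      · have a3 := key j (k + 2) (by omega)
        rw [if_neg (by omega), if_neg (by omega), if_neg (by omega)]
        linear_combination B * a1 - A * a2 + a3

theorem lowE_det {R : Type*} [CommRing R] (A B : R) (n : ℕ) :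
    Matrix.det (Matrix.of fun j k : Fin n => lowE A B j k) = 1 := by
  rw [Matrix.det_of_lowerTriangular]
  · apply Finset.prod_eq_one
    intro i _
    simp only [lowE, Matrix.of_apply]
    by_cases h : 2 ≤ (i : ℕ)
    · have h1 : (i : ℕ) ≠ i - 1 := by omega
      have h2 : (i : ℕ) ≠ i - 2 := by omega
      simp [h1, h2]
    · simp [h]
  · intro i j hij
    have hij : (i : ℕ) < j := hij
    have h0 : (j : ℕ) ≠ i := by omega
    have h1 : (j : ℕ) ≠ i - 1 := by omega
    have h2 : (j : ℕ) ≠ i - 2 := by omega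
    simp [lowE, h0, h1, h2]

theorem stmt_2 {R : Type*} [CommRing R] (A B : R) (n : ℕ) (hn : 0 < n) :
    Matrix.det (Matrix.of fun j k : Fin n => lucasU A B ((j : ℤ) - (k : ℤ)).natAbs) =
      (-1) ^ (n - 1) * lucasU (2 * A) ((B + 1) ^ 2) (n - 1) := by
  set M := (Matrix.of fun j k : Fin n => lucasU A B ((j : ℤ) - (k : ℤ)).natAbs) with hM
  set E := (Matrix.of fun j k : Fin n => lowE A B j k) with hE
  have hprod : E * M * E.transpose = Matrix.of fun j k : Fin n =>
      triE (fun i => if 2 ≤ i then -2 * A else 0) (fun i => if 1 ≤ i then B + 1 else 1) j k := by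
    ext j k
    rw [Matrix.of_apply, ← op_eval, ← lowE_sum A B n k k.2, Matrix.mul_apply]
    refine Finset.sum_congr rfl fun l _ => ?_
    rw [← lowE_sum A B n j j.2, Matrix.mul_apply, mul_comm]
    rfl
  have hdet := congrArg Matrix.det hprod
  rw [Matrix.det_mul, Matrix.det_mul, Matrix.det_transpose, hE, lowE_det, one_mul, mul_one] at hdet
  rw [hdet]
  change triD _ _ n = _
  rcases n with _ | _ | n
  · omega
  · simp [triD, triE, lucasU]
  · rw [triD_rec]
    have := triD_const A B n
    simp at this ⊢
    rw [this]
    ring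
end

section
/- For any integer n ≥ 2 and any element q of a commutative ring R, det[[|j−k|]_q]_{1≤j,k≤n} = (−1)^{n−1}·(n−1)·(q+1)^{n−2}, where [m]_q = 1 + q + ... + q^{m−1} (and [0]_q = 0). -/
namespace QDet
variable {R : Type*} [CommRing R]

def a (q : R) (i k : ℕ) : R := ∑ l ∈ Finset.range ((i : ℤ) - (k : ℤ)).natAbs, q ^ l

def b (q : R) : ℕ → ℕ → R
  | 0, k => a q 0 k
  | i+1, k => if k ≤ i then q ^ (i - k) else - q ^ (k - i - 1)

def c (q : R) : ℕ → ℕ → R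
  | 0, k => a q 0 k
  | 1, k => b q 1 k
  | i+2, k => if k ≤ i then 0 else if k = i + 1 then 1 + q else -(1+q)*(1-q)*q^(k-i-2)

def d (q : R) : ℕ → ℕ → R
  | 0, k => if k = 0 then 0 else 1
  | 1, k => if k = 0 then 1 else if k = 1 then -1 else 0
  | i+2, k => if k = i + 1 then 1 + q else if k = i + 2 then -(1+q) else 0

def t (q : R) (n : ℕ) : ℕ → ℕ → R
  | 0, k => if k = 0 then (n : R) - 1 else (n : R) - k
  | 1, k => if k = 1 then -1 else 0
  | i+2, k => if k = i + 2 then -(1+q) else 0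

def s (R : Type*) [CommRing R] (l k : ℕ) : R := if l = k then 1 else if l = k + 1 then -1 else 0

lemma hab (q : R) (i k : ℕ) : a q (i+1) k = b q (i+1) k + 1 * a q i k := by
  simp only [b, a]
  split_ifs with h
  · obtain ⟨e, rfl⟩ := Nat.exists_eq_add_of_le h
    rw [show (((k + e + 1 : ℕ) : ℤ) - (k:ℤ)).natAbs = e + 1 by omega,
      show (((k + e : ℕ) : ℤ) - (k:ℤ)).natAbs = e by omega, Finset.sum_range_succ]
    simp [add_comm]
  · obtain ⟨e, rfl⟩ := Nat.exists_eq_add_of_le (show i + 1 ≤ k by omega)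
    rw [show (((i + 1 : ℕ) : ℤ) - ((i+1+e : ℕ):ℤ)).natAbs = e by omega,
      show ((i : ℤ) - ((i+1+e : ℕ):ℤ)).natAbs = e + 1 by omega, Finset.sum_range_succ,
      show i + 1 + e - i - 1 = e by omega]
    ring

lemma hbc (q : R) (i k : ℕ) :
    b q (i+1) k = c q (i+1) k + (if i = 0 then 0 else q) * b q i k := by
  rcases i with _ | i
  · simp [c]
  · simp only [b, c]
    rcases lt_trichotomy k (i+1) with h | h | h
    · obtain ⟨e, rfl⟩ := Nat.exists_eq_add_of_le (show k ≤ i by omega)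
      have h1 : k ≤ k + e + 1 := by omega
      simp [h1, show k + e + 1 - k = e + 1 by omega, pow_succ, mul_comm]
    · subst h
      simp
    · obtain ⟨e, rfl⟩ := Nat.exists_eq_add_of_le (show i + 2 ≤ k by omega)
      simp [show ¬ (i + 2 + e ≤ i + 1) by omega, show ¬ (i + 2 + e ≤ i) by omega,
        show ¬ (i + 2 + e = i + 1) by omega, show i + 2 + e - (i+1) - 1 = e by omega,
        show i + 2 + e - i - 1 = e + 1 by omega, show i + 2 + e - i - 2 = e by omega]
      ring

lemma a0 (q : R) (k : ℕ) : a q 0 k = ∑ l ∈ Finset.range k, q ^ l := by simp [a]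

lemma hcd (q : R) (i k : ℕ) :
    c q i (k+1) = d q i (k+1) + (if k = 0 then 0 else q) * c q i k := by
  rcases i with _ | _ | i
  · simp only [c, d, a0]
    rcases k with _ | k
    · simp
    · rw [Finset.sum_range_succ', Finset.mul_sum]
      simp [pow_succ', add_comm]
  · rcases k with _ | k
    · simp [c, d, b]
    · simp [c, d, b, pow_succ']
  · simp only [c, d]
    rcases lt_trichotomy k (i+1) with h | h | h
    · by_cases hk : k = i
      · subst hk; simp
      · simp [show k + 1 ≤ i by omega, show k ≤ i by omega, hk, show k ≠ i + 1 by omega]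
    · subst h
      simp [show i + 1 + 1 - i - 2 = 0 by omega]
      ring
    · obtain ⟨e, rfl⟩ := Nat.exists_eq_add_of_le (show i + 2 ≤ k by omega)
      simp [show ¬ (i + 2 + e + 1 ≤ i) by omega, show ¬ (i + 2 + e ≤ i) by omega,
        show ¬ (i + 2 + e = i + 1) by omega, show ¬ (i + 2 + e = i) by omega,
        show i + 2 + e + 1 - i - 2 = e + 1 by omega, show i + 2 + e - i - 2 = e by omega]
      ring

lemma hc0 (q : R) (i : ℕ) : c q i 0 = d q i 0 := by
  rcases i with _ | _ | i <;> simp [c, d, a0, b]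

lemma hdt (q : R) (n : ℕ) :
    (Matrix.of fun i k : Fin n => d q i k) =
      (Matrix.of fun i k : Fin n => t q n i k) * (Matrix.of fun i k : Fin n => s R i k) := by
  ext ⟨i, hi⟩ ⟨k, hk⟩
  simp only [Matrix.mul_apply, Matrix.of_apply]
  rw [Fin.sum_univ_eq_sum_range (fun l => t q n i l * s R l k) n]
  have key : ∑ l ∈ Finset.range n, t q n i l * s R l k
      = t q n i k - (if k + 1 < n then t q n i (k+1) else 0) := by
    have : ∀ l, t q n i l * s R l k
        = (if l = k then t q n i l else 0) - (if l = k + 1 then t q n i l else 0) := by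
      intro l
      unfold s
      split_ifs <;> first | omega | simp
    simp [this, Finset.sum_sub_distrib, Finset.sum_ite_eq', hk]
  rw [key]
  rcases i with _ | _ | i
  · simp only [t, d]
    rcases k with _ | k
    · by_cases h : 1 < n
      · simp [h]
      · have : n = 1 := by omega
        subst this; simp
    · by_cases h : k + 1 + 1 < n
      · simp [h]
      · have : n = k + 2 := by omega
        subst this; simp; ring
  · simp only [t, d]
    rcases k with _ | _ | k <;> simp [hi]
  · simp only [t, d]
    split_ifs <;> first | omega | simp

lemma hs (n : ℕ) : (Matrix.of fun i k : Fin n => s R i k).det = 1 := by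
  rw [Matrix.det_of_isLowerTriangular]
  · simp [s]
  · intro i j h
    have : (i : ℕ) < j := h
    simp [s, show ¬ ((i:ℕ) = j) by omega, show ¬ ((i:ℕ) = j + 1) by omega]

lemma ht (q : R) (m : ℕ) : (Matrix.of fun i k : Fin (m+2) => t q (m+2) i k).det =
    (-1) ^ (m+1) * (((m+2 : ℕ) : R) - 1) * (q + 1) ^ m := by
  rw [Matrix.det_of_isUpperTriangular]
  · simp [Fin.prod_univ_succ, t, -neg_add_rev]
    rw [neg_pow (1 + q)]
    ring
  · intro i j h
    have h : (j : ℕ) < i := h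
    obtain ⟨i, hi⟩ := i
    rcases i with _ | _ | i
    · simp at h
    · simp at h; simp [t, h]
    · simp at h; simp [t]; omega

end QDet

open QDet in
theorem stmt_6 {R : Type*} [CommRing R] (q : R) (n : ℕ) (hn : 2 ≤ n) :
    Matrix.det (Matrix.of fun j k : Fin n =>
        ∑ i ∈ Finset.range ((j : ℤ) - (k : ℤ)).natAbs, q ^ i) =
      (-1) ^ (n - 1) * ((n : R) - 1) * (q + 1) ^ (n - 2) := by
  obtain ⟨m, rfl⟩ := Nat.exists_eq_add_of_le' hn
  have h1 : (Matrix.of fun i k : Fin (m+2) => a q i k).det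
      = (Matrix.of fun i k : Fin (m+2) => b q i k).det :=
    Matrix.det_eq_of_forall_row_eq_smul_add_pred (fun _ => 1) (fun j => by simp [b])
      (fun i j => by simpa using hab q i j)
  have h2 : (Matrix.of fun i k : Fin (m+2) => b q i k).det
      = (Matrix.of fun i k : Fin (m+2) => c q i k).det :=
    Matrix.det_eq_of_forall_row_eq_smul_add_pred (fun i => if (i : ℕ) = 0 then 0 else q)
      (fun j => by simp [b, c]) (fun i j => by simpa only [Matrix.of_apply, Fin.val_succ, Fin.val_castSucc] using hbc q i j)
  have h3 : (Matrix.of fun i k : Fin (m+2) => c q i k).det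
      = (Matrix.of fun i k : Fin (m+2) => d q i k).det :=
    Matrix.det_eq_of_forall_col_eq_smul_add_pred (fun i => if (i : ℕ) = 0 then 0 else q)
      (fun i => hc0 q i) (fun i j => by simpa only [Matrix.of_apply, Fin.val_succ, Fin.val_castSucc] using hcd q i j)
  have h4 := h1.trans (h2.trans h3)
  rw [hdt, Matrix.det_mul, hs, ht, mul_one] at h4
  exact h4
end
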